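/- Let M = (W, ≤, R, V) be a sharp model and M♭ = (W♭, ≼, 𝓡, V♭) the corresponding flat model, where W♭ = {(w,v) | w ∈ W, wRv} ∪ {(w,•) | w ∈ W, R[w] = ∅}, (w,v) ≼ (w',v') iff w ≤ w', (w,v) 𝓡 (w',v') iff v ≤ w', and V♭(p) = {(w,v) ∈ W♭ | w ∈ V(p)}. Then for all (w,v) ∈ W♭ and all formulas φ ∈ L⇛: M, w ⊨ˢ φ if and only if M♭, (w,v) ⊨ φ. -/

import Mathlib

/-- Formulas of the language `L⇛`. -/
inductive Fml : Type where
  | var : Nat → Fml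
  | top : Fml
  | bot : Fml
  | and : Fml → Fml → Fml
  | or  : Fml → Fml → Fml
  | imp : Fml → Fml → Fml
  | sto : Fml → Fml → Fml
deriving DecidableEq

/-- Uniform substitution. -/
def Fml.subst (σ : Nat → Fml) : Fml → Fml
  | .var p => σ p
  | .top => .top
  | .bot => .bot
  | .and φ ψ => .and (φ.subst σ) (ψ.subst σ)
  | .or φ ψ => .or (φ.subst σ) (ψ.subst σ)
  | .imp φ ψ => .imp (φ.subst σ) (ψ.subst σ)
  | .sto φ ψ => .sto (φ.subst σ) (ψ.subst σ)

/-- Conjunction `φ₁ ∧ ⋯ ∧ φₙ` of a list of formulas (`⊤` for the empty list). -/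
def Fml.conj : List Fml → Fml
  | [] => .top
  | [φ] => φ
  | φ :: ψ :: rest => .and φ (Fml.conj (ψ :: rest))

/-- Disjunction `φ₁ ∨ ⋯ ∨ φₙ` of a list of formulas (`⊥` for the empty list). -/
def Fml.disj : List Fml → Fml
  | [] => .bot
  | [φ] => φ
  | φ :: ψ :: rest => .or φ (Fml.disj (ψ :: rest))

/-- A flat frame: a nonempty set of worlds with a preorder `≼` and a relation `R`. -/
structure FlatFrame : Type 1 where
  W : Type
  ne : Nonempty W
  le : W → W → Prop
  le_refl : ∀ w, le w w
  le_trans : ∀ ⦃w v u⦄, le w v → le v u → le w u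
  R : W → W → Prop

/-- A valuation is admissible if every proposition letter denotes an upset. -/
def FlatFrame.IsUpset (F : FlatFrame) (V : Nat → F.W → Prop) : Prop :=
  ∀ p ⦃w v⦄, F.le w v → V p w → V p v

/-- Truth of a formula at a world of a flat model: the usual intuitionistic Kripke
clauses over `≼`, and `w ⊨ φ⇛ψ` iff for every `w' ≽ w`, `R[w'] ⊆ ⟦φ⟧` implies
`R[w'] ⊆ ⟦ψ⟧`. -/
def FlatFrame.sat (F : FlatFrame) (V : Nat → F.W → Prop) : Fml → F.W → Prop
  | .var p, w => V p w
  | .top, _ => True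
  | .bot, _ => False
  | .and φ ψ, w => F.sat V φ w ∧ F.sat V ψ w
  | .or φ ψ, w => F.sat V φ w ∨ F.sat V ψ w
  | .imp φ ψ, w => ∀ v, F.le w v → F.sat V φ v → F.sat V ψ v
  | .sto φ ψ, w => ∀ w', F.le w w' →
      (∀ v, F.R w' v → F.sat V φ v) → ∀ v, F.R w' v → F.sat V ψ v

/-- A flat frame validates the consecution `Γ ⇒ φ` if in every model on it, every
world satisfying all formulas of `Γ` satisfies `φ`. -/
def FlatFrame.ValidCons (F : FlatFrame) (Γ : Set Fml) (φ : Fml) : Prop :=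
  ∀ V, F.IsUpset V → ∀ w, (∀ ψ ∈ Γ, F.sat V ψ w) → F.sat V φ w

/-- A flat frame validates a formula if it is true at every world in every model on it. -/
def FlatFrame.ValidFml (F : FlatFrame) (φ : Fml) : Prop :=
  ∀ V, F.IsUpset V → ∀ w, F.sat V φ w

/-- A sharp model: a partial order `≤`, a relation `R` with `w ≤ v R u → w R u`,
and a valuation interpreting proposition letters as upsets. -/
structure SharpModel : Type 1 where
  W : Type
  ne : Nonempty W
  le : W → W → Prop
  le_refl : ∀ w, le w w
  le_trans : ∀ ⦃w v u⦄, le w v → le v u → le w u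
  le_antisymm : ∀ ⦃w v⦄, le w v → le v w → w = v
  R : W → W → Prop
  back : ∀ ⦃w v u⦄, le w v → R v u → R w u
  V : Nat → W → Prop
  V_up : ∀ p ⦃w v⦄, le w v → V p w → V p v

/-- Sharp satisfaction `⊨ˢ`: intuitionistic clauses and
`w ⊨ˢ φ⇛ψ` iff every `R`-successor of `w` satisfying `φ` satisfies `ψ`. -/
def SharpModel.sat (M : SharpModel) : Fml → M.W → Prop
  | .var p, w => M.V p w
  | .top, _ => True
  | .bot, _ => False
  | .and φ ψ, w => M.sat φ w ∧ M.sat ψ w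
  | .or φ ψ, w => M.sat φ w ∨ M.sat ψ w
  | .imp φ ψ, w => ∀ v, M.le w v → M.sat φ v → M.sat ψ v
  | .sto φ ψ, w => ∀ v, M.R w v → M.sat φ v → M.sat ψ v

/-- The worlds of the flat companion `M♭`: pairs `(w,v)` with `w R v`, together
with pairs `(w,•)` for worlds with `R[w] = ∅` (here `•` is `none`). -/
def SharpModel.FlatW (M : SharpModel) : Type :=
  {p : M.W × Option M.W //
    match p.2 with
    | some v => M.R p.1 v
    | none => ∀ v, ¬ M.R p.1 v}

/-- The flat companion frame of a sharp model: `(w,v) ≼ (w',v')` iff `w ≤ w'`, and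
`(w,v) 𝓡 (w',v')` iff `v ≤ w'` (worlds `(w,•)` have no `𝓡`-successors). -/
def SharpModel.flatify (M : SharpModel) : FlatFrame where
  W := M.FlatW
  ne := by
    classical
    obtain ⟨w⟩ := M.ne
    by_cases h : ∃ v, M.R w v
    · obtain ⟨v, hv⟩ := h
      exact ⟨⟨(w, some v), hv⟩⟩
    · push_neg at h
      exact ⟨⟨(w, none), h⟩⟩
  le x y := M.le x.1.1 y.1.1
  le_refl x := M.le_refl _
  le_trans := fun _ _ _ h h' => M.le_trans h h'
  R x y :=
    match x.1.2 with
    | some v => M.le v y.1.1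
    | none => False

/-- The valuation `V♭` of the flat companion model. -/
def SharpModel.flatVal (M : SharpModel) : Nat → M.FlatW → Prop :=
  fun p x => M.V p x.1.1

/-- Sharp satisfaction is persistent along `≤`. -/
theorem SharpModel.sat_mono (M : SharpModel) (φ : Fml) {w v : M.W} (h : M.le w v)
    (hw : M.sat φ w) : M.sat φ v := by
  induction φ with
  | var p => exact M.V_up p h hw
  | top => trivial
  | bot => exact hw
  | and φ ψ ihφ ihψ => exact ⟨ihφ hw.1, ihψ hw.2⟩
  | or φ ψ ihφ ihψ => exact hw.imp ihφ ihψ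
  | imp φ ψ => exact fun u hu => hw u (M.le_trans h hu)
  | sto φ ψ => exact fun u hu => hw u (M.back h hu)

/-- Every world of a sharp model is the first component of a world of its flat companion. -/
theorem SharpModel.exists_flatW (M : SharpModel) (w : M.W) : ∃ x : M.FlatW, x.1.1 = w := by
  by_cases h : ∃ v, M.R w v
  · obtain ⟨v, hv⟩ := h
    exact ⟨⟨(w, some v), hv⟩, rfl⟩
  · exact ⟨⟨(w, none), not_exists.mp h⟩, rfl⟩

/-- truth is preserved between a sharp model `M` and its flat
companion `M♭`: for all `(w,v) ∈ W♭` and all formulas `φ`,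
`M, w ⊨ˢ φ` iff `M♭, (w,v) ⊨ φ`. -/
theorem sharp_to_flat_truth (M : SharpModel) (φ : Fml) (x : M.FlatW) :
    M.sat φ x.1.1 ↔ (M.flatify).sat M.flatVal φ x := by
  induction φ generalizing x with
  | var p => exact Iff.rfl
  | top => exact Iff.rfl
  | bot => exact Iff.rfl
  | and φ ψ ihφ ihψ => exact and_congr (ihφ x) (ihψ x)
  | or φ ψ ihφ ihψ => exact or_congr (ihφ x) (ihψ x)
  | imp φ ψ ihφ ihψ =>
    constructor
    · intro h y hy hφ
      exact (ihψ y).1 (h _ hy ((ihφ y).2 hφ))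
    · intro h v hv hφ
      obtain ⟨y, rfl⟩ := M.exists_flatW v
      exact (ihψ y).2 (h y hv ((ihφ y).1 hφ))
  | sto φ ψ ihφ ihψ =>
    constructor
    · rintro h ⟨⟨w, _ | v⟩, hwv⟩ hw hφ y hy
      · exact hy.elim
      · obtain ⟨z, rfl⟩ := M.exists_flatW v
        have hz : M.sat φ z.1.1 := (ihφ z).2 (hφ z (M.le_refl _))
        exact (ihψ y).1 (M.sat_mono ψ hy (h _ (M.back hw hwv) hz))
    · intro h v hv hφ
      obtain ⟨z, rfl⟩ := M.exists_flatW v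
      exact (ihψ z).2 (h ⟨(x.1.1, some z.1.1), hv⟩ (M.le_refl _)
        (fun y hy => (ihφ y).1 (M.sat_mono φ hy hφ)) z (M.le_refl _))
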